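/- Let I₁, I₀ : [0,1] → ℝ be differentiable, set I(η̂, η) = η·I₁(η̂) + (1 - η)·I₀(η̂) and J(η) = I(η, η), and assume J is differentiable and that I(η̂, η) ≤ J(η) for all η̂, η ∈ [0,1]. Then for every η in the open interval (0,1), I₁(η) = J(η) + (1 - η)·J'(η) and I₀(η) = J(η) - η·J'(η). -/

import Mathlib

open Set

/-- Savage's representation: if `I₁, I₀` are differentiable on `[0,1]`, the total
reward is `I v η = η * I₁ v + (1 - η) * I₀ v`, the maximum reward is
`J η = I η η`, `J` is differentiable, and `I v η ≤ J η` for all `v, η ∈ [0,1]`,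
then for every `η` in the open interval `(0,1)`:
`I₁ η = J η + (1 - η) * J' η` and `I₀ η = J η - η * J' η`. -/
theorem stmt_3 (I₁ I₀ J : ℝ → ℝ)
    (hI₁ : ∀ x ∈ Icc (0:ℝ) 1, DifferentiableAt ℝ I₁ x)
    (hI₀ : ∀ x ∈ Icc (0:ℝ) 1, DifferentiableAt ℝ I₀ x)
    (hJdef : ∀ η : ℝ, J η = η * I₁ η + (1 - η) * I₀ η)
    (hJ : ∀ x ∈ Icc (0:ℝ) 1, DifferentiableAt ℝ J x)
    (hle : ∀ v ∈ Icc (0:ℝ) 1, ∀ η ∈ Icc (0:ℝ) 1,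
      η * I₁ v + (1 - η) * I₀ v ≤ J η) :
    ∀ η ∈ Ioo (0:ℝ) 1,
      I₁ η = J η + (1 - η) * deriv J η ∧ I₀ η = J η - η * deriv J η := by
  intro η hη
  have hηI := Ioo_subset_Icc_self hη
  have hmin : IsLocalMin (fun t => J t - (t * I₁ η + (1 - t) * I₀ η)) η := by
    filter_upwards [Icc_mem_nhds hη.1 hη.2] with t ht
    linarith [hle η hηI t ht, hJdef η]
  have hline : HasDerivAt (fun t => t * I₁ η + (1 - t) * I₀ η) (1 * I₁ η + -1 * I₀ η) η :=
    ((hasDerivAt_id η).mul_const _).add (((hasDerivAt_id η).const_sub 1).mul_const _)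
  have hslope : deriv J η = I₁ η - I₀ η := by
    linarith [hmin.hasDerivAt_eq_zero ((hJ η hηI).hasDerivAt.sub hline)]
  rw [hslope, hJdef η]
  constructor <;> ring
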